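/- arXiv:2401.09996 — 2 statements merged into one kernel-verified Lean document; each statement's English description precedes it below -/
import Mathlib

section
/- Translation bounds for Dirichlet polynomial norms: let 1 ≤ p < ∞, let λ_N ≤ λ_{N+1} ≤ ⋯ ≤ λ_M be real frequencies, and for σ > 0 let D_σ = Σ_{n=N}^M a_n e^{-λ_n σ} e^{-λ_n s} denote the translation of the Dirichlet polynomial D = Σ_{n=N}^M a_n e^{-λ_n s}. Then e^{-λ_M σ} ‖D‖_p ≤ ‖D_σ‖_p ≤ e^{-λ_N σ} ‖D‖_p, where ‖·‖_p is the Besicovitch p-norm lim_{T→∞} ((1/2T)∫_{-T}^T |·|^p dt)^{1/p}. -/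
open Finset Filter

open MeasureTheory in
lemma tnb_avg_shift2 (φ : ℝ → ℝ) (hφ : Continuous φ) (K : ℝ) (hK : ∀ t, ‖φ t‖ ≤ K) (A : ℝ)
    (hA : Tendsto (fun T : ℝ => (1 / (2 * T)) * ∫ t in (-T)..T, φ t) atTop (nhds A)) (x : ℝ) :
    Tendsto (fun T : ℝ => (1 / (2 * T)) * ∫ t in (-T)..T, φ (t + x)) atTop (nhds A) := by
  have hz : Tendsto (fun T : ℝ => (1 / (2 * T)) * (∫ t in (-T)..T, φ (t + x))
      - (1 / (2 * T)) * ∫ t in (-T)..T, φ t) atTop (nhds 0) := by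
    have hlim : Tendsto (fun T : ℝ => (K * |x|) * T⁻¹) atTop (nhds 0) := by
      simpa using tendsto_inv_atTop_zero.const_mul (K * |x|)
    refine squeeze_zero_norm' ?_ hlim
    filter_upwards [eventually_gt_atTop 0] with T hT
    have hi : ∀ a b : ℝ, IntervalIntegrable φ volume a b := fun a b => hφ.intervalIntegrable a b
    rw [← mul_sub, intervalIntegral.integral_comp_add_right,
      intervalIntegral.integral_interval_sub_interval_comm' (hi _ _) (hi _ _) (hi _ _)]
    have h1 := intervalIntegral.norm_integral_le_of_norm_le_const (a := T) (b := T + x)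
      (f := φ) (C := K) (fun t _ => hK t)
    have h2 := intervalIntegral.norm_integral_le_of_norm_le_const (a := -T) (b := -T + x)
      (f := φ) (C := K) (fun t _ => hK t)
    simp only [add_sub_cancel_left] at h1 h2
    rw [norm_mul, Real.norm_of_nonneg (by positivity)]
    calc _ ≤ 1 / (2 * T) * (K * |x| + K * |x|) := by
          gcongr
          exact (norm_sub_le _ _).trans (add_le_add h1 h2)
      _ = _ := by field_simp; ring
  simpa using hz.add hA

open MeasureTheory in
lemma tnb_contr (p : ℝ) (hp : 1 ≤ p) (ν : Measure ℝ) [IsProbabilityMeasure ν]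
    (F G : ℝ → ℂ) (hF : Continuous F) (hG : Continuous G) (C : ℝ) (hC : ∀ t, ‖F t‖ ≤ C)
    (hFG : ∀ t, G t = ∫ x, F (t + x) ∂ν) (A B : ℝ)
    (hA : Tendsto (fun T : ℝ => (1 / (2 * T)) * ∫ t in (-T)..T, ‖F t‖ ^ p) atTop (nhds A))
    (hB : Tendsto (fun T : ℝ => (1 / (2 * T)) * ∫ t in (-T)..T, ‖G t‖ ^ p) atTop (nhds B)) :
    B ≤ A := by
  have hp0 : 0 ≤ p := by linarith
  set φ : ℝ → ℝ := fun t => ‖F t‖ ^ p with hφd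
  have hφ : Continuous φ := hF.norm.rpow_const (fun _ => Or.inr hp0)
  have hφ0 : ∀ t, 0 ≤ φ t := fun t => by positivity
  have hK : ∀ t, ‖φ t‖ ≤ C ^ p := fun t => by
    rw [Real.norm_of_nonneg (hφ0 t)]
    exact Real.rpow_le_rpow (norm_nonneg _) (hC t) hp0
  have hK0 : 0 ≤ C ^ p := (norm_nonneg _).trans (hK 0)
  have hint : ∀ t, Integrable (fun x => φ (t + x)) ν := fun t =>
    Integrable.of_bound (by fun_prop) (C ^ p) (ae_of_all _ fun x => hK _)
  have hJ : ∀ t, ‖G t‖ ^ p ≤ ∫ x, φ (t + x) ∂ν := by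
    intro t
    have h1 : ‖G t‖ ≤ ∫ x, ‖F (t + x)‖ ∂ν := by
      rw [hFG]; exact norm_integral_le_integral_norm _
    refine (Real.rpow_le_rpow (norm_nonneg _) h1 hp0).trans ?_
    exact (convexOn_rpow hp).map_integral_le (μ := ν) (f := fun x => ‖F (t + x)‖)
      (Real.continuous_rpow_const hp0).continuousOn isClosed_Ici
      (ae_of_all _ fun x => norm_nonneg _)
      (Integrable.of_bound (by fun_prop) C (ae_of_all _ fun x => by simpa using hC _)) (hint t)
  have hlim : Tendsto (fun T : ℝ => ∫ x, (1 / (2 * T)) * (∫ t in (-T)..T, φ (t + x)) ∂ν)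
      atTop (nhds (∫ _, A ∂ν)) := by
    refine tendsto_integral_filter_of_dominated_convergence (fun _ => C ^ p) ?_ ?_
      (integrable_const _) (ae_of_all _ fun x => tnb_avg_shift2 φ hφ _ hK A hA x)
    · filter_upwards with T
      refine Continuous.aestronglyMeasurable ?_
      refine continuous_const.mul ?_
      exact intervalIntegral.continuous_parametric_intervalIntegral_of_continuous' (by fun_prop) _ _
    · filter_upwards [eventually_gt_atTop 0] with T hT
      refine ae_of_all _ fun x => ?_
      have h1 := intervalIntegral.norm_integral_le_of_norm_le_const (a := -T) (b := T)
        (f := fun t => φ (t + x)) (C := C ^ p) (fun t _ => hK _)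
      rw [norm_mul, Real.norm_of_nonneg (by positivity)]
      calc _ ≤ 1 / (2 * T) * (C ^ p * |T - -T|) := by gcongr
        _ = _ := by rw [abs_of_pos (by linarith)]; field_simp; ring
  simp only [integral_const, probReal_univ, one_smul] at hlim
  refine le_of_tendsto_of_tendsto hB hlim ?_
  filter_upwards [eventually_gt_atTop 0] with T hT
  rw [integral_const_mul]
  gcongr
  have hprod : Integrable (Function.uncurry fun (t x : ℝ) => φ (t + x))
      ((volume.restrict (Set.Ioc (-T) T)).prod ν) :=
    Integrable.of_bound (by unfold Function.uncurry; fun_prop) (C ^ p) (ae_of_all _ fun x => hK _)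
  simp only [intervalIntegral.integral_of_le (show -T ≤ T by linarith)]
  rw [← integral_integral_swap hprod]
  refine integral_mono ?_ hprod.integral_prod_left hJ
  exact ((hG.norm.rpow_const (fun _ => Or.inr hp0)).integrableOn_Icc).mono_set Set.Ioc_subset_Icc_self

open MeasureTheory FourierTransform in
lemma tnb_poisson (σ : ℝ) (hσ : 0 < σ) : ∃ ν : Measure ℝ, IsProbabilityMeasure ν ∧
    ∀ v : ℝ, ∫ x : ℝ, Complex.exp (((v * x : ℝ) : ℂ) * Complex.I) ∂ν =
      (Real.exp (-|v| * σ) : ℂ) := by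
  have hpi := Real.pi_pos
  set f : ℝ → ℂ := fun x => (Real.exp (-|x| * σ) : ℂ) with hf
  set h : ℝ → ℝ := fun w => 2 * σ / (σ ^ 2 + (2 * Real.pi * w) ^ 2) with hh
  have hden : ∀ w : ℝ, 0 < σ ^ 2 + (2 * Real.pi * w) ^ 2 := fun w => by positivity
  have h0 : ∀ w, 0 ≤ h w := fun w => div_nonneg (by linarith) (hden w).le
  have hcont : Continuous h := by
    refine Continuous.div (by fun_prop) (by fun_prop) (fun w => (hden w).ne')
  have hfc : Continuous f := by fun_prop
  have e1 : ∀ w : ℝ, Set.EqOn (fun v : ℝ => Complex.exp (((-2 * Real.pi * v * w : ℝ) : ℂ) * Complex.I) • f v)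
      (fun v : ℝ => Complex.exp ((-σ - 2 * Real.pi * w * Complex.I) * v)) (Set.Ioi 0) := by
    intro w v hv
    have hv : 0 < v := hv
    simp only [hf, smul_eq_mul, abs_of_pos hv, Complex.ofReal_exp, ← Complex.exp_add]
    congr 1; push_cast; ring
  have e2 : ∀ w : ℝ, Set.EqOn (fun v : ℝ => Complex.exp (((-2 * Real.pi * v * w : ℝ) : ℂ) * Complex.I) • f v)
      (fun v : ℝ => Complex.exp ((σ - 2 * Real.pi * w * Complex.I) * v)) (Set.Iic 0) := by
    intro w v hv
    have hv : v ≤ 0 := hv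
    simp only [hf, smul_eq_mul, abs_of_nonpos hv, Complex.ofReal_exp, ← Complex.exp_add]
    congr 1; push_cast; ring
  have r1 : ∀ w : ℝ, (-σ - 2 * Real.pi * w * Complex.I : ℂ).re < 0 := fun w => by simpa using hσ
  have r2 : ∀ w : ℝ, 0 < (σ - 2 * Real.pi * w * Complex.I : ℂ).re := fun w => by simpa using hσ
  have i1 : ∀ w : ℝ, IntegrableOn (fun v : ℝ => Complex.exp (((-2 * Real.pi * v * w : ℝ) : ℂ) * Complex.I) • f v) (Set.Ioi 0) :=
    fun w => (integrableOn_exp_mul_complex_Ioi (r1 w) 0).congr_fun (e1 w).symm measurableSet_Ioi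
  have i2 : ∀ w : ℝ, IntegrableOn (fun v : ℝ => Complex.exp (((-2 * Real.pi * v * w : ℝ) : ℂ) * Complex.I) • f v) (Set.Iic 0) :=
    fun w => (integrableOn_exp_mul_complex_Iic (r2 w) 0).congr_fun (e2 w).symm measurableSet_Iic
  have hfi : Integrable f := by
    have := (i2 0).union (i1 0)
    rw [Set.Iic_union_Ioi, integrableOn_univ] at this
    simpa using this
  have hF : 𝓕 f = fun w => (h w : ℂ) := by
    ext w
    rw [Real.fourier_real_eq_integral_exp_smul, ← intervalIntegral.integral_Iic_add_Ioi (i2 w) (i1 w),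
      setIntegral_congr_fun measurableSet_Iic (e2 w), setIntegral_congr_fun measurableSet_Ioi (e1 w),
      integral_exp_mul_complex_Ioi (r1 w), integral_exp_mul_complex_Iic (r2 w)]
    have n1 : (-σ - 2 * Real.pi * w * Complex.I : ℂ) ≠ 0 := fun hc => by
      have := r1 w; rw [hc] at this; simp at this
    have n2 : (σ - 2 * Real.pi * w * Complex.I : ℂ) ≠ 0 := fun hc => by
      have := r2 w; rw [hc] at this; simp at this
    have n3 : ((σ : ℂ) ^ 2 + (2 * Real.pi * w) ^ 2) ≠ 0 := by
      exact_mod_cast (hden w).ne'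
    simp only [hh, Complex.ofReal_zero, mul_zero, Complex.exp_zero]
    push_cast
    rw [div_add_div _ _ n2 n1, div_eq_div_iff (mul_ne_zero n2 n1) n3]
    ring_nf
    simp only [Complex.I_sq]
    ring
  have hhi : Integrable h := by
    have := (integrable_inv_one_add_sq.comp_mul_left' (R := 2 * Real.pi / σ) (by positivity)).const_mul (2 / σ)
    refine this.congr (ae_of_all _ fun w => ?_)
    simp only [hh]
    have := (hden w).ne'
    have h3 : 1 + (2 * Real.pi / σ * w) ^ 2 = (σ ^ 2 + (2 * Real.pi * w) ^ 2) / σ ^ 2 := by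
      field_simp
    rw [h3]
    field_simp
  have hinv : ∀ v : ℝ, ∫ w : ℝ, Complex.exp (((2 * Real.pi * (w * v) : ℝ) : ℂ) * Complex.I) * (h w : ℂ) = f v := by
    intro v
    have := congrFun (hfc.fourierInv_fourier_eq hfi (by rw [hF]; exact hhi.ofReal)) v
    rw [hF, Real.fourierInv_eq'] at this
    rw [← this]
    congr 1; ext w
    simp [mul_comm]
  have hone : ∫ w, h w = 1 := by
    have := hinv 0
    simp only [mul_zero, Complex.ofReal_zero, zero_mul, Complex.exp_zero, one_mul, hf, abs_zero,
      neg_zero, Real.exp_zero] at this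
    rw [integral_complex_ofReal] at this
    exact_mod_cast this
  let ν0 : Measure ℝ := volume.withDensity (fun w => ENNReal.ofReal (h w))
  have hν0 : IsProbabilityMeasure ν0 := by
    constructor
    rw [withDensity_apply _ MeasurableSet.univ, Measure.restrict_univ,
      ← ofReal_integral_eq_lintegral_ofReal hhi (ae_of_all _ h0), hone, ENNReal.ofReal_one]
  refine ⟨ν0.map (fun x => 2 * Real.pi * x), Measure.isProbabilityMeasure_map (by fun_prop), ?_⟩
  intro v
  rw [integral_map (by fun_prop) (by fun_prop)]
  rw [integral_withDensity_eq_integral_toReal_smul (by fun_prop) (ae_of_all _ fun _ => ENNReal.ofReal_lt_top)]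
  rw [show (Real.exp (-|v| * σ) : ℂ) = f v from rfl, ← hinv v]
  congr 1; ext w
  rw [ENNReal.toReal_ofReal (h0 w), Complex.real_smul, mul_comm]
  congr 4; ring

open MeasureTheory in
lemma tnb_poly (p : ℝ) (hp : 1 ≤ p) (M : ℕ) (lam : Fin (M + 1) → ℝ) (b c : Fin (M + 1) → ℂ)
    (l0 k : ℝ) (σ : ℝ) (hσ : 0 < σ)
    (hc : ∀ n, b n * (Real.exp (-|lam n - l0| * σ) : ℂ) = (Real.exp k : ℂ) * c n) (A B : ℝ)
    (hA : Tendsto (fun T : ℝ => (1 / (2 * T)) *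
        ∫ t in (-T)..T, ‖∑ n, b n * Complex.exp (-(lam n * t) * Complex.I)‖ ^ p)
      atTop (nhds A))
    (hB : Tendsto (fun T : ℝ => (1 / (2 * T)) *
        ∫ t in (-T)..T, ‖∑ n, c n * Complex.exp (-(lam n * t) * Complex.I)‖ ^ p)
      atTop (nhds B)) :
    Real.exp k * B ^ (1 / p) ≤ A ^ (1 / p) := by
  have hp0 : 0 < p := by linarith
  obtain ⟨ν, hν, hch⟩ := tnb_poisson σ hσ
  have hB0 : 0 ≤ B := by
    refine ge_of_tendsto hB ?_
    filter_upwards [eventually_gt_atTop 0] with T hT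
    exact mul_nonneg (by positivity)
      (intervalIntegral.integral_nonneg (by linarith) fun t _ => by positivity)
  have hu : ∀ t : ℝ, ‖Complex.exp (((l0 * t : ℝ) : ℂ) * Complex.I)‖ = 1 := fun t =>
    Complex.norm_exp_ofReal_mul_I _
  have hfac : ∀ (d : Fin (M + 1) → ℂ) (t : ℝ),
      ∑ n, d n * Complex.exp (((-(lam n - l0) * t : ℝ) : ℂ) * Complex.I) =
      Complex.exp (((l0 * t : ℝ) : ℂ) * Complex.I) *
        ∑ n, d n * Complex.exp (-(lam n * t) * Complex.I) := by
    intro d t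
    rw [Finset.mul_sum]
    refine Finset.sum_congr rfl fun n _ => ?_
    rw [mul_left_comm, ← Complex.exp_add]
    congr 2; push_cast; ring
  have key := tnb_contr p hp ν
    (fun t => ∑ n, b n * Complex.exp (((-(lam n - l0) * t : ℝ) : ℂ) * Complex.I))
    (fun t => (Real.exp k : ℂ) * ∑ n, c n * Complex.exp (((-(lam n - l0) * t : ℝ) : ℂ) * Complex.I))
    (by fun_prop) (by fun_prop) (∑ n, ‖b n‖)
    (fun t => (norm_sum_le _ _).trans (Finset.sum_le_sum fun n _ => by
      rw [norm_mul, Complex.norm_exp_ofReal_mul_I, mul_one]))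
    (fun t => by
      have hs : ∀ x : ℝ, ∀ n, b n * Complex.exp (((-(lam n - l0) * (t + x) : ℝ) : ℂ) * Complex.I)
          = (b n * Complex.exp (((-(lam n - l0) * t : ℝ) : ℂ) * Complex.I)) *
            Complex.exp (((-(lam n - l0) * x : ℝ) : ℂ) * Complex.I) := fun x n => by
        rw [mul_assoc, ← Complex.exp_add]
        congr 2; push_cast; ring
      simp only [hs]
      rw [integral_finset_sum]
      · rw [Finset.mul_sum]
        refine Finset.sum_congr rfl fun n _ => ?_
        rw [integral_const_mul, hch, abs_neg, ← mul_assoc, ← hc]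
        ring
      · intro n _
        refine Integrable.const_mul ?_ _
        exact Integrable.of_bound (by fun_prop) 1
          (ae_of_all _ fun x => (Complex.norm_exp_ofReal_mul_I _).le)) A (Real.exp k ^ p * B)
    (by simpa only [hfac, norm_mul, hu, one_mul] using hA)
    (by
      simp only [hfac, norm_mul, hu, one_mul]
      have hn : ‖(Real.exp k : ℂ)‖ = Real.exp k := by
        rw [Complex.norm_real, Real.norm_of_nonneg (Real.exp_pos k).le]
      simp only [hn, Real.mul_rpow (Real.exp_pos k).le (norm_nonneg _),
        intervalIntegral.integral_const_mul]
      refine (hB.const_mul (Real.exp k ^ p)).congr fun T => ?_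
      ring)
  have h2 := Real.rpow_le_rpow (by positivity) key (show 0 ≤ 1 / p by positivity)
  rwa [Real.mul_rpow (by positivity) hB0, ← Real.rpow_mul (Real.exp_pos k).le,
    mul_one_div_cancel hp0.ne', Real.rpow_one] at h2

/-- Translation bounds for Besicovitch norms of Dirichlet polynomials:
`e^{-λ_M σ} ‖D‖_p ≤ ‖D_σ‖_p ≤ e^{-λ_N σ} ‖D‖_p`. -/
theorem translation_norm_bounds (p : ℝ) (hp : 1 ≤ p) (M : ℕ) (lam : Fin (M + 1) → ℝ)
    (hlam : Monotone lam) (a : Fin (M + 1) → ℂ) (σ : ℝ) (hσ : 0 < σ) (Dp Np : ℝ)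
    (hD : Tendsto (fun T : ℝ => (1 / (2 * T)) *
        ∫ t in (-T)..T, ‖∑ n, a n * Complex.exp (-(lam n * t) * Complex.I)‖ ^ p)
      atTop (nhds Dp))
    (hN : Tendsto (fun T : ℝ => (1 / (2 * T)) *
        ∫ t in (-T)..T, ‖∑ n, a n * (Real.exp (-(lam n) * σ) : ℂ) *
          Complex.exp (-(lam n * t) * Complex.I)‖ ^ p)
      atTop (nhds Np)) :
    Real.exp (-(lam (Fin.last M)) * σ) * Dp ^ (1 / p) ≤ Np ^ (1 / p) ∧
      Np ^ (1 / p) ≤ Real.exp (-(lam 0) * σ) * Dp ^ (1 / p) := by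
  constructor
  · refine tnb_poly p hp M lam _ a (lam (Fin.last M)) _ σ hσ (fun n => ?_) Np Dp hN hD
    have h1 : lam n ≤ lam (Fin.last M) := hlam (Fin.le_last n)
    rw [abs_of_nonpos (by linarith), mul_assoc, ← Complex.ofReal_mul, ← Real.exp_add, mul_comm]
    congr 3; ring
  · have h := tnb_poly p hp M lam a _ (lam 0) (lam 0 * σ) σ hσ (fun n => ?_) Dp Np hD hN
    · calc Np ^ (1 / p) = Real.exp (-(lam 0) * σ) * (Real.exp (lam 0 * σ) * Np ^ (1 / p)) := by
            rw [← mul_assoc, ← Real.exp_add]; simp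
        _ ≤ _ := by gcongr
    have h1 : lam 0 ≤ lam n := hlam (Fin.zero_le n)
    rw [abs_of_nonneg (by linarith), mul_left_comm, ← Complex.ofReal_mul, ← Real.exp_add]
    congr 3; ring
end

section
/- Upper bound for Λ_{2k,2} via additive energy with a logarithmic loss: there is an absolute constant C > 0 such that for any finite set A ⊆ ℝ and integer k ≥ 1, Λ_{2k,2}(A) ≤ C √(log(#A + 2)) · sup_{A' ⊆ A} E_k(A')^{1/(2k)} / √(#A'). -/
open Finset Filter
open scoped Classical

/-- The `k`-th additive energy of a finite set of reals. -/
noncomputable def addEnergy (k : ℕ) (A : Finset ℝ) : ℕ :=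
  (((Fintype.piFinset fun _ : Fin k => A) ×ˢ Fintype.piFinset fun _ : Fin k => A).filter
    fun p => ∑ i, p.1 i = ∑ i, p.2 i).card

/-- The Besicovitch `r`-norm of a function on the real line. -/
noncomputable def bNorm (r : ℝ) (f : ℝ → ℂ) : ℝ :=
  (Filter.limsup (fun T : ℝ => (1 / (2 * T)) * ∫ t in (-T)..T, ‖f t‖ ^ r)
    Filter.atTop) ^ (1 / r)

open Topology

lemma mean_exp (θ : ℝ) :
    Tendsto (fun T : ℝ => ((1 / (2 * T) : ℝ) : ℂ) * ∫ t in (-T)..T, Complex.exp ((θ * t : ℝ) * Complex.I))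
      atTop (𝓝 (if θ = 0 then 1 else 0)) := by
  split_ifs with h
  · subst h
    refine tendsto_const_nhds.congr' ?_
    filter_upwards [eventually_gt_atTop 0] with T hT
    have : (T : ℂ) ≠ 0 := by exact_mod_cast hT.ne'
    simp
    field_simp
    ring
  · rw [tendsto_zero_iff_norm_tendsto_zero]
    have h1 : Tendsto (fun T : ℝ => (1 / |θ|) * T⁻¹) atTop (𝓝 0) := by
      simpa using tendsto_inv_atTop_zero.const_mul (1 / |θ|)
    refine squeeze_zero' (Eventually.of_forall fun _ => norm_nonneg _) ?_ h1
    filter_upwards [eventually_gt_atTop 0] with T hT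
    have hc : (θ * Complex.I : ℂ) ≠ 0 := by simp [h]
    have e : ∀ t : ℝ, Complex.exp ((θ * t : ℝ) * Complex.I) = Complex.exp ((θ * Complex.I) * t) := by
      intro t; congr 1; push_cast; ring
    simp_rw [e]
    rw [integral_exp_mul_complex hc, norm_mul, norm_div]
    have h2 : ∀ t : ℝ, ‖Complex.exp ((θ * Complex.I) * t)‖ = 1 := by
      intro t; rw [← e]; exact Complex.norm_exp_ofReal_mul_I _
    have h3 : ‖Complex.exp ((θ * Complex.I) * T) - Complex.exp ((θ * Complex.I) * (-T : ℝ))‖ ≤ 2 := by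
      refine (norm_sub_le _ _).trans ?_
      rw [h2, h2]; norm_num
    have h4 : ‖(θ * Complex.I : ℂ)‖ = |θ| := by simp
    have h5 : ‖((1 / (2 * T) : ℝ) : ℂ)‖ = 1 / (2 * T) := by
      rw [Complex.norm_real, Real.norm_of_nonneg]; positivity
    rw [h4, h5]
    have h6 : 0 < |θ| := abs_pos.2 h
    calc _ ≤ 1 / (2 * T) * (2 / |θ|) := by gcongr
      _ = _ := by field_simp

lemma mean_sq {ι : Type*} (I : Finset ι) (w : ι → ℝ) (c : ι → ℂ) :
    Tendsto (fun T : ℝ => (1 / (2 * T)) *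
      ∫ t in (-T)..T, ‖∑ i ∈ I, c i * Complex.exp (-(w i * t) * Complex.I)‖ ^ 2)
      atTop (𝓝 (∑ p ∈ (I ×ˢ I).filter (fun p => w p.1 = w p.2),
        c p.1 * (starRingEnd ℂ) (c p.2)).re) := by
  have key : ∀ t : ℝ, ((‖∑ i ∈ I, c i * Complex.exp (-(w i * t) * Complex.I)‖ ^ 2 : ℝ) : ℂ)
      = ∑ p ∈ I ×ˢ I, (c p.1 * (starRingEnd ℂ) (c p.2)) *
        Complex.exp (((w p.2 - w p.1) * t : ℝ) * Complex.I) := by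
    intro t
    push_cast
    rw [← Complex.mul_conj', map_sum, Finset.sum_mul_sum, ← Finset.sum_product']
    refine Finset.sum_congr rfl fun p _ => ?_
    rw [map_mul, ← Complex.exp_conj]
    have : Complex.exp (((w p.2 - w p.1 : ℂ) * t ) * Complex.I) =
      Complex.exp (-(w p.1 * t) * Complex.I) * Complex.exp ((starRingEnd ℂ) (-(w p.2 * t) * Complex.I)) := by
      rw [← Complex.exp_add]; congr 1
      simp
      ring
    rw [this]; ring
  have h1 : Tendsto (fun T : ℝ => ∑ p ∈ I ×ˢ I, (c p.1 * (starRingEnd ℂ) (c p.2)) *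
      (((1 / (2 * T) : ℝ) : ℂ) * ∫ t in (-T)..T,
        Complex.exp (((w p.2 - w p.1) * t : ℝ) * Complex.I))) atTop
      (𝓝 (∑ p ∈ I ×ˢ I, (c p.1 * (starRingEnd ℂ) (c p.2)) *
        (if w p.2 - w p.1 = 0 then 1 else 0))) :=
    tendsto_finsetSum _ fun p _ => (mean_exp _).const_mul _
  have h2 := (Complex.continuous_re.tendsto _).comp h1
  have e : (∑ p ∈ (I ×ˢ I).filter (fun p => w p.1 = w p.2), c p.1 * (starRingEnd ℂ) (c p.2))
      = (∑ p ∈ I ×ˢ I, (c p.1 * (starRingEnd ℂ) (c p.2)) *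
        (if w p.2 - w p.1 = 0 then 1 else 0)) := by
    rw [Finset.sum_filter]
    refine Finset.sum_congr rfl fun p _ => ?_
    simp only [sub_eq_zero, eq_comm (a := w p.2), mul_ite, mul_one, mul_zero]
  rw [e]
  refine h2.congr fun T => ?_
  simp only [Function.comp]
  have : (∑ p ∈ I ×ˢ I, (c p.1 * (starRingEnd ℂ) (c p.2)) *
      (((1 / (2 * T) : ℝ) : ℂ) * ∫ t in (-T)..T,
        Complex.exp (((w p.2 - w p.1) * t : ℝ) * Complex.I))) =
      (((1 / (2 * T)) *
      ∫ t in (-T)..T, ‖∑ i ∈ I, c i * Complex.exp (-(w i * t) * Complex.I)‖ ^ 2 : ℝ) : ℂ) := by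
    rw [Complex.ofReal_mul, ← intervalIntegral.integral_ofReal]
    simp_rw [key]
    rw [intervalIntegral.integral_finsetSum]
    · rw [Finset.mul_sum]
      refine Finset.sum_congr rfl fun p _ => ?_
      rw [intervalIntegral.integral_const_mul]; ring
    · intro p _
      apply Continuous.intervalIntegrable
      fun_prop
  rw [this, Complex.ofReal_re]

lemma pow_expand (k : ℕ) (A : Finset ℝ) (a : ℝ → ℂ) (t : ℝ) :
    (∑ x ∈ A, a x * Complex.exp (-(x * t) * Complex.I)) ^ k =
    ∑ p ∈ Fintype.piFinset (fun _ : Fin k => A), (∏ i, a (p i)) *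
      Complex.exp (-((∑ i, p i : ℝ) * t) * Complex.I) := by
  have := Finset.prod_univ_sum (fun _ : Fin k => A)
    (fun _ x => a x * Complex.exp (-(x * t) * Complex.I))
  rw [Finset.prod_const, Finset.card_univ, Fintype.card_fin] at this
  rw [this]
  refine Finset.sum_congr rfl fun p _ => ?_
  rw [Finset.prod_mul_distrib, ← Complex.exp_sum]
  congr 2
  push_cast
  rw [← Finset.sum_mul, Finset.sum_neg_distrib, ← Finset.sum_mul]

lemma mean_pow (k : ℕ) (A : Finset ℝ) (a : ℝ → ℂ) :
    ∃ L : ℝ, Tendsto (fun T : ℝ => (1 / (2 * T)) *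
      ∫ t in (-T)..T, ‖∑ x ∈ A, a x * Complex.exp (-(x * t) * Complex.I)‖ ^ (2 * k)) atTop (𝓝 L) ∧
      ∀ M : ℝ, 0 ≤ M → (∀ x ∈ A, ‖a x‖ ≤ M) → L ≤ M ^ (2 * k) * addEnergy k A := by
  refine ⟨_, (mean_sq (Fintype.piFinset (fun _ : Fin k => A)) (fun p => ∑ i, p i)
    (fun p => ∏ i, a (p i))).congr fun T => ?_, ?_⟩
  · congr 2
    ext t
    rw [← pow_expand, norm_pow, ← pow_mul, mul_comm]
  · intro M hM h
    refine (Complex.re_le_norm _).trans ((norm_sum_le _ _).trans ?_)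
    have hp : ∀ p ∈ Fintype.piFinset (fun _ : Fin k => A), ‖∏ i, a (p i)‖ ≤ M ^ k := by
      intro p hp
      rw [norm_prod]
      rw [Fintype.mem_piFinset] at hp
      refine (Finset.prod_le_prod (fun _ _ => norm_nonneg _) fun i _ => h _ (hp i)).trans ?_
      simp
    refine (Finset.sum_le_card_nsmul _ _ (M ^ (2 * k)) ?_).trans ?_
    · intro p hpp
      rw [Finset.mem_filter, Finset.mem_product] at hpp
      rw [norm_mul, RCLike.norm_conj, two_mul, pow_add]
      exact mul_le_mul (hp _ hpp.1.1) (hp _ hpp.1.2) (norm_nonneg _) (by positivity)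
    · rw [nsmul_eq_mul, mul_comm]
      rfl

lemma mean_two (A : Finset ℝ) (a : ℝ → ℂ) :
    Tendsto (fun T : ℝ => (1 / (2 * T)) *
      ∫ t in (-T)..T, ‖∑ x ∈ A, a x * Complex.exp (-(x * t) * Complex.I)‖ ^ 2) atTop
      (𝓝 (∑ x ∈ A, ‖a x‖ ^ 2)) := by
  convert mean_sq A (fun x => x) a using 2
  rw [Finset.sum_filter, Finset.sum_product]
  simp only [Finset.sum_ite_eq, Complex.re_sum]
  refine Finset.sum_congr rfl fun x hx => ?_
  rw [if_pos hx, Complex.mul_conj']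
  norm_cast

lemma bNorm_of_tendsto (n : ℕ) (r : ℝ) (hr : r = n) (f : ℝ → ℂ) (L : ℝ)
    (h : Tendsto (fun T : ℝ => (1 / (2 * T)) * ∫ t in (-T)..T, ‖f t‖ ^ n) atTop (𝓝 L)) :
    bNorm r f = L ^ (1 / r) := by
  subst hr
  unfold bNorm
  simp_rw [Real.rpow_natCast]
  rw [h.limsup_eq]

/-- Minkowski by Jensen. -/
lemma jensen_pt (s : Finset ℕ) (B : ℕ → ℝ) (hB : ∀ j ∈ s, 0 < B j) (hs : s.Nonempty)
    (z : ℕ → ℂ) (n : ℕ) :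
    ‖∑ j ∈ s, z j‖ ^ n ≤ ∑ j ∈ s, (∑ j ∈ s, B j) ^ n * (B j / (∑ j ∈ s, B j)) *
      (‖z j‖ ^ n / B j ^ n) := by
  set S := ∑ j ∈ s, B j with hS
  have hSpos : 0 < S := Finset.sum_pos hB hs
  have h1 := Real.pow_arith_mean_le_arith_mean_pow s (fun j => B j / S) (fun j => S * (‖z j‖ / B j))
    (fun j hj => (div_pos (hB j hj) hSpos).le)
    (by rw [← Finset.sum_div, div_self hSpos.ne'])
    (fun j hj => mul_nonneg hSpos.le (div_nonneg (norm_nonneg _) (hB j hj).le)) n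
  have h2 : ∑ j ∈ s, B j / S * (S * (‖z j‖ / B j)) = ∑ j ∈ s, ‖z j‖ := by
    refine Finset.sum_congr rfl fun j hj => ?_
    have := (hB j hj).ne'
    field_simp
  rw [h2] at h1
  refine (pow_le_pow_left₀ (norm_nonneg _) (norm_sum_le _ _) n).trans (h1.trans (le_of_eq ?_))
  refine Finset.sum_congr rfl fun j hj => ?_
  rw [mul_pow, div_pow]; ring

lemma minkowski (s : Finset ℕ) (B : ℕ → ℝ) (hB : ∀ j ∈ s, 0 < B j) (hs : s.Nonempty)
    (F : ℕ → ℝ → ℂ) (hF : ∀ j, Continuous (F j)) (n : ℕ) (L : ℕ → ℝ) (L0 : ℝ)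
    (hL : ∀ j ∈ s, Tendsto (fun T : ℝ => (1 / (2 * T)) * ∫ t in (-T)..T, ‖F j t‖ ^ n) atTop (𝓝 (L j)))
    (hLB : ∀ j ∈ s, L j ≤ B j ^ n)
    (h0 : Tendsto (fun T : ℝ => (1 / (2 * T)) * ∫ t in (-T)..T, ‖∑ j ∈ s, F j t‖ ^ n) atTop (𝓝 L0)) :
    L0 ≤ (∑ j ∈ s, B j) ^ n := by
  set S := ∑ j ∈ s, B j with hS
  have hSpos : 0 < S := Finset.sum_pos hB hs
  have h1 : Tendsto (fun T : ℝ => ∑ j ∈ s, S ^ n * (B j / S) / B j ^ n *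
      ((1 / (2 * T)) * ∫ t in (-T)..T, ‖F j t‖ ^ n)) atTop
      (𝓝 (∑ j ∈ s, S ^ n * (B j / S) / B j ^ n * L j)) :=
    tendsto_finsetSum _ fun j hj => (hL j hj).const_mul _
  have h2 : L0 ≤ ∑ j ∈ s, S ^ n * (B j / S) / B j ^ n * L j := by
    refine le_of_tendsto_of_tendsto h0 h1 ?_
    filter_upwards [eventually_gt_atTop 0] with T hT
    have e : ∑ j ∈ s, S ^ n * (B j / S) / B j ^ n * ((1 / (2 * T)) * ∫ t in (-T)..T, ‖F j t‖ ^ n)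
        = (1 / (2 * T)) * ∫ t in (-T)..T, ∑ j ∈ s, S ^ n * (B j / S) * (‖F j t‖ ^ n / B j ^ n) := by
      rw [intervalIntegral.integral_finsetSum]
      · rw [Finset.mul_sum]
        refine Finset.sum_congr rfl fun j _ => ?_
        rw [intervalIntegral.integral_const_mul, intervalIntegral.integral_div]; ring
      · intro j _
        apply Continuous.intervalIntegrable
        have := hF j
        fun_prop
    rw [e]
    refine mul_le_mul_of_nonneg_left ?_ (by positivity)
    refine intervalIntegral.integral_mono_on (by linarith) ?_ ?_ ?_
    · apply Continuous.intervalIntegrable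
      fun_prop
    · apply Continuous.intervalIntegrable
      fun_prop
    · intro t _
      exact jensen_pt s B hB hs (fun j => F j t) n
  refine h2.trans ?_
  calc _ ≤ ∑ j ∈ s, S ^ n * (B j / S) := by
        refine Finset.sum_le_sum fun j hj => ?_
        have hb := hB j hj
        rw [div_mul_eq_mul_div, div_le_iff₀ (by positivity)]
        exact mul_le_mul_of_nonneg_left (hLB j hj) (by positivity)
    _ = S ^ n := by rw [← Finset.mul_sum, ← Finset.sum_div, div_self hSpos.ne', mul_one]

lemma addEnergy_pos (k : ℕ) (A : Finset ℝ) (hA : A.Nonempty) : 0 < addEnergy k A := by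
  obtain ⟨x, hx⟩ := hA
  refine Finset.card_pos.2 ⟨(fun _ => x, fun _ => x), ?_⟩
  simp [hx]

lemma level_count (n : ℕ) (hn : 1 ≤ n) :
    ((Nat.log 2 n + 2 : ℕ) : ℝ) ≤ 5 * Real.log (n + 2) := by
  have h1 : (1 : ℝ) ≤ Real.log (n + 2) := by
    rw [Real.le_log_iff_exp_le (by positivity)]
    have : (1 : ℝ) ≤ n := by exact_mod_cast hn
    linarith [Real.exp_one_lt_d9]
  have h2 : (Nat.log 2 n : ℝ) * Real.log 2 ≤ Real.log (n + 2) := by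
    rw [← Real.log_pow]
    apply Real.log_le_log (by positivity)
    have : 2 ^ Nat.log 2 n ≤ n := Nat.pow_log_le_self 2 (by omega)
    have : (2 : ℝ) ^ Nat.log 2 n ≤ n := by exact_mod_cast this
    linarith
  have h3 := Real.log_two_gt_d9
  have h4 : (0 : ℝ) ≤ Nat.log 2 n := by positivity
  push_cast
  nlinarith

lemma main_bound (A : Finset ℝ) (hA : A.Nonempty) (k : ℕ) (hk : 1 ≤ k) (a : ℝ → ℂ) (S L0 : ℝ)
    (hS : ∀ A' ⊆ A, A'.Nonempty → (addEnergy k A' : ℝ) ^ (1 / (2 * k : ℝ)) / Real.sqrt A'.card ≤ S)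
    (h0 : Tendsto (fun T : ℝ => (1 / (2 * T)) *
      ∫ t in (-T)..T, ‖∑ x ∈ A, a x * Complex.exp (-(x * t) * Complex.I)‖ ^ (2 * k)) atTop (𝓝 L0)) :
    L0 ≤ (5 * Real.sqrt (Real.log (A.card + 2)) * S * Real.sqrt (∑ x ∈ A, ‖a x‖ ^ 2)) ^ (2 * k) := by
  obtain ⟨x0, hx0, hmax⟩ := Finset.exists_max_image A (fun x => ‖a x‖) hA
  set M := ‖a x0‖ with hM
  have hSpos : 0 < S := by
    refine lt_of_lt_of_le ?_ (hS A subset_rfl hA)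
    have h1 : (0 : ℝ) < addEnergy k A := by exact_mod_cast addEnergy_pos k A hA
    have h2 : (0 : ℝ) < A.card := by exact_mod_cast hA.card_pos
    positivity
  set R := ∑ x ∈ A, ‖a x‖ ^ 2 with hR
  have hMR : M ^ 2 ≤ R :=
    Finset.single_le_sum (f := fun x => ‖a x‖ ^ 2) (fun _ _ => by positivity) hx0
  rcases (norm_nonneg (a x0)).eq_or_lt with hM0 | hMpos
  · obtain ⟨L, hL, hLb⟩ := mean_pow k A a
    rw [tendsto_nhds_unique h0 hL]
    refine (hLb 0 le_rfl fun x hx => (hmax x hx).trans hM0.ge).trans ?_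
    rw [zero_pow (by omega), zero_mul]
    positivity
  change 0 < M at hMpos
  set J := Nat.log 2 A.card + 1 with hJ
  let ℓ : ℝ → ℕ := fun x => Nat.findGreatest (fun j => ‖a x‖ ≤ M / 2 ^ j) J
  have hℓJ : ∀ x, ℓ x ≤ J := fun x => Nat.findGreatest_le J
  have hℓ1 : ∀ x ∈ A, ‖a x‖ ≤ M / 2 ^ (ℓ x) := fun x hx =>
    Nat.findGreatest_spec (P := fun j => ‖a x‖ ≤ M / 2 ^ j) (Nat.zero_le J) (by simpa using hmax x hx)
  have hℓ2 : ∀ x, ℓ x < J → M / 2 ^ (ℓ x + 1) < ‖a x‖ := fun x hx =>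
    not_le.1 (Nat.findGreatest_is_greatest (P := fun j => ‖a x‖ ≤ M / 2 ^ j) (Nat.lt_succ_self _) hx)
  let D : ℕ → Finset ℝ := fun j => A.filter fun x => ℓ x = j
  let s : Finset ℕ := A.image ℓ
  have hs : s.Nonempty := hA.image _
  have hD : ∀ j ∈ s, (D j).Nonempty := by
    intro j hj
    obtain ⟨x, hx, rfl⟩ := Finset.mem_image.1 hj
    exact ⟨x, Finset.mem_filter.2 ⟨hx, rfl⟩⟩
  have hscard : s.card ≤ J + 1 := by
    have : s ⊆ Finset.range (J + 1) := by
      intro j hj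
      obtain ⟨x, hx, rfl⟩ := Finset.mem_image.1 hj
      exact Finset.mem_range.2 (Nat.lt_succ_of_le (hℓJ x))
    simpa using Finset.card_le_card this
  let B : ℕ → ℝ := fun j => M / 2 ^ j * S * Real.sqrt (D j).card
  have hB : ∀ j ∈ s, 0 < B j := by
    intro j hj
    have : (0 : ℝ) < (D j).card := by exact_mod_cast (hD j hj).card_pos
    simp only [B]
    positivity
  choose L hL hLb using fun j => mean_pow k (D j) a
  have hk0 : (2 * k : ℝ) ≠ 0 := by positivity
  have hE : ∀ j ∈ s, (addEnergy k (D j) : ℝ) ≤ (S * Real.sqrt (D j).card) ^ (2 * k) := by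
    intro j hj
    have h1 := hS (D j) (Finset.filter_subset _ _) (hD j hj)
    have : (0 : ℝ) < (D j).card := by exact_mod_cast (hD j hj).card_pos
    rw [div_le_iff₀ (by positivity)] at h1
    have h2 := pow_le_pow_left₀ (by positivity) h1 (2 * k)
    rwa [← Real.rpow_natCast, ← Real.rpow_mul (by positivity), Nat.cast_mul, Nat.cast_ofNat,
      one_div_mul_cancel hk0, Real.rpow_one] at h2
  have hmink : L0 ≤ (∑ j ∈ s, B j) ^ (2 * k) := by
    refine minkowski s B hB hs
      (fun j t => ∑ x ∈ D j, a x * Complex.exp (-(x * t) * Complex.I)) (fun j => by fun_prop)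
      (2 * k) L L0 (fun j _ => hL j) ?_ ?_
    · intro j hj
      refine (hLb j (M / 2 ^ j) (by positivity) ?_).trans ?_
      · intro x hx
        obtain ⟨hxA, hxj⟩ := Finset.mem_filter.1 hx
        rw [← hxj]; exact hℓ1 x hxA
      · simp only [B]
        rw [mul_assoc, mul_pow]
        exact mul_le_mul_of_nonneg_left (hE j hj) (by positivity)
    · refine h0.congr fun T => ?_
      congr 2
      ext t
      congr 2
      exact (Finset.sum_fiberwise_of_maps_to (fun x hx => Finset.mem_image_of_mem ℓ hx) _).symm
  refine hmink.trans (pow_le_pow_left₀ (Finset.sum_nonneg fun j hj => (hB j hj).le) ?_ _)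
  have hRpart : ∑ j ∈ s, ∑ x ∈ D j, ‖a x‖ ^ 2 = R :=
    Finset.sum_fiberwise_of_maps_to (fun x hx => Finset.mem_image_of_mem ℓ hx) _
  have hBsq : ∀ j ∈ s, B j ^ 2 ≤ 4 * S ^ 2 * ∑ x ∈ D j, ‖a x‖ ^ 2 + if j = J then S ^ 2 * R else 0 := by
    intro j hj
    have hBe : B j ^ 2 = S ^ 2 * ((M / 2 ^ j) ^ 2 * (D j).card) := by
      simp only [B]
      rw [mul_pow, Real.sq_sqrt (by positivity)]; ring
    have hsum : 0 ≤ ∑ x ∈ D j, ‖a x‖ ^ 2 := Finset.sum_nonneg fun _ _ => by positivity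
    split_ifs with hjJ
    · rw [hjJ] at hBe hsum ⊢
      have h1 : ((D J).card : ℝ) ≤ 2 ^ J := by
        have h2 : (D J).card ≤ A.card := Finset.card_le_card (Finset.filter_subset _ _)
        have h3 : A.card < 2 ^ (Nat.log 2 A.card + 1) := Nat.lt_pow_succ_log_self (by norm_num) _
        exact_mod_cast h2.trans h3.le
      have h4 : (1 : ℝ) ≤ 2 ^ J := one_le_pow₀ (by norm_num)
      have h5 : (M / 2 ^ J) ^ 2 * (D J).card ≤ M ^ 2 := by
        rw [div_pow, div_mul_eq_mul_div, div_le_iff₀ (by positivity)]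
        refine mul_le_mul_of_nonneg_left ?_ (by positivity)
        nlinarith
      have h6 : B J ^ 2 ≤ S ^ 2 * R := by
        rw [hBe]
        exact mul_le_mul_of_nonneg_left (h5.trans hMR) (by positivity)
      have : 0 ≤ 4 * S ^ 2 * ∑ x ∈ D J, ‖a x‖ ^ 2 := by positivity
      linarith
    · have h1 : ∀ x ∈ D j, (M / 2 ^ j) ^ 2 / 4 ≤ ‖a x‖ ^ 2 := by
        intro x hx
        obtain ⟨hxA, hxj⟩ := Finset.mem_filter.1 hx
        have h2 := hℓ2 x (lt_of_le_of_ne (hℓJ x) (by rw [hxj]; exact hjJ))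
        rw [hxj] at h2
        have h3 := pow_le_pow_left₀ (by positivity) h2.le 2
        refine le_trans (le_of_eq ?_) h3
        field_simp; ring
      have h2 := Finset.card_nsmul_le_sum _ _ _ h1
      rw [nsmul_eq_mul] at h2
      rw [hBe]
      have : (M / 2 ^ j) ^ 2 * (D j).card ≤ 4 * ∑ x ∈ D j, ‖a x‖ ^ 2 := by linarith
      calc _ ≤ S ^ 2 * (4 * ∑ x ∈ D j, ‖a x‖ ^ 2) := mul_le_mul_of_nonneg_left this (by positivity)
        _ = _ := by ring
  have hR0 : 0 ≤ R := le_trans (by positivity) hMR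
  have hBsum : ∑ j ∈ s, B j ^ 2 ≤ 5 * S ^ 2 * R := by
    refine (Finset.sum_le_sum hBsq).trans ?_
    rw [Finset.sum_add_distrib, ← Finset.mul_sum, hRpart, Finset.sum_ite_eq']
    have : 0 ≤ S ^ 2 * R := by positivity
    split_ifs <;> linarith
  have hlog := level_count A.card hA.card_pos
  have hlog0 : 0 ≤ Real.log (A.card + 2) := Real.log_nonneg (by
    have : (0 : ℝ) ≤ A.card := by positivity
    linarith)
  refine abs_le_of_sq_le_sq' ?_ (by positivity) |>.2
  have hCS := sq_sum_le_card_mul_sum_sq (s := s) (f := B)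
  have hsc : (s.card : ℝ) ≤ 5 * Real.log (A.card + 2) := le_trans (by exact_mod_cast hscard) hlog
  calc _ ≤ _ := hCS
    _ ≤ (5 * Real.log (A.card + 2)) * (5 * S ^ 2 * R) :=
      mul_le_mul hsc hBsum (Finset.sum_nonneg fun _ _ => by positivity) (by positivity)
    _ = _ := by
      rw [mul_pow, mul_pow, mul_pow, Real.sq_sqrt hlog0, Real.sq_sqrt hR0]; ring

/-- Upper bound for `Λ_{2k,2}` via additive energy with a logarithmic loss:
`Λ_{2k,2}(A) ≤ C √(log(#A + 2)) · sup_{A' ⊆ A} E_k(A')^{1/2k}/√(#A')` for an absolute `C`. -/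
theorem lambda_upper_bound_energy :
    ∃ C > (0 : ℝ), ∀ (A : Finset ℝ) (k : ℕ), 1 ≤ k → ∀ a : ℝ → ℂ,
      bNorm (2 * k) (fun t => ∑ x ∈ A, a x * Complex.exp (-(x * t) * Complex.I)) ≤
        C * Real.sqrt (Real.log (A.card + 2)) *
          (A.powerset.sup' ⟨∅, Finset.empty_mem_powerset A⟩ fun A' =>
            (addEnergy k A' : ℝ) ^ (1 / (2 * k : ℝ)) / Real.sqrt A'.card) *
          bNorm 2 (fun t => ∑ x ∈ A, a x * Complex.exp (-(x * t) * Complex.I)) := by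
  refine ⟨5, by norm_num, fun A k hk a => ?_⟩
  obtain ⟨L, hL, hLb⟩ := mean_pow k A a
  have hk0 : (2 * k : ℝ) ≠ 0 := by positivity
  have hLnn : 0 ≤ L := by
    refine ge_of_tendsto hL ?_
    filter_upwards [eventually_gt_atTop 0] with T hT
    refine mul_nonneg (by positivity) (intervalIntegral.integral_nonneg (by linarith) fun _ _ => by positivity)
  rw [bNorm_of_tendsto (2 * k) (2 * k) (by push_cast; rfl) _ L hL,
    bNorm_of_tendsto 2 2 (by norm_num) _ _ (mean_two A a), ← Real.sqrt_eq_rpow]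
  rcases A.eq_empty_or_nonempty with rfl | hA
  · have : L ≤ 0 := by
      have := hLb 0 le_rfl (by simp)
      rwa [zero_pow (by omega), zero_mul] at this
    rw [le_antisymm this hLnn, Real.zero_rpow (by positivity)]
    simp
  set S := A.powerset.sup' ⟨∅, Finset.empty_mem_powerset A⟩ fun A' =>
            (addEnergy k A' : ℝ) ^ (1 / (2 * k : ℝ)) / Real.sqrt A'.card with hSdef
  have hS : ∀ A' ⊆ A, (addEnergy k A' : ℝ) ^ (1 / (2 * k : ℝ)) / Real.sqrt A'.card ≤ S := by
    intro A' h
    exact Finset.le_sup' (fun A' : Finset ℝ =>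
      (addEnergy k A' : ℝ) ^ (1 / (2 * k : ℝ)) / Real.sqrt A'.card) (Finset.mem_powerset.2 h)
  have hS0 : 0 ≤ S := le_trans (by positivity) (hS A subset_rfl)
  have := main_bound A hA k hk a S L (fun A' h _ => hS A' h) hL
  have h2 := Real.rpow_le_rpow hLnn this (z := 1 / (2 * k : ℝ)) (by positivity)
  refine h2.trans (le_of_eq ?_)
  rw [← Real.rpow_natCast, ← Real.rpow_mul (by positivity), Nat.cast_mul, Nat.cast_ofNat,
    mul_one_div_cancel hk0, Real.rpow_one]
end
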